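/- arXiv:2106.07871 — 3 statements merged into one kernel-verified Lean document; each statement's English description precedes it below -/
import Mathlib

section
/- Let G = (V, E) be a loopless connected multigraph with V = {v_1, …, v_n} and E = {e_1, …, e_m}, and assign to each edge e_j the indeterminate weight ω(e_j) = y_j. Then the following polynomial identity holds: ∏_{i=1}^{n−1} ( ∑_{e_j ∈ E_G(v_i)} y_j ) = τ(G, ω) + ∑_{T_0 ∈ NST_{v_n}(G)} τ(T_0, ω) · F(G − V(T_0), ω), where the sum is over all non-spanning subtrees T_0 of G containing v_n. -/
/-- A loopless undirected multigraph with vertex type `V` and edge type `E`: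
every edge `e` is assigned an unordered pair `G.inc e` of two *distinct*
endpoints (parallel edges are allowed since `E` is an abstract edge type). -/
structure Multigraph (V : Type) (E : Type) where
  inc : E → Sym2 V
  loopless : ∀ e : E, ¬ (inc e).IsDiag

namespace Multigraph

variable {V E : Type}

/-- The degree of a vertex `v` in `G`: the number of edges incident with `v`. -/
noncomputable def deg (G : Multigraph V E) (v : V) : ℕ :=
  {e : E | v ∈ G.inc e}.ncard

/-- Adjacency using only edges from the edge set `F`. -/
def AdjOn (G : Multigraph V E) (F : Set E) (a b : V) : Prop :=
  ∃ e ∈ F, G.inc e = s(a, b)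

/-- Reachability using only edges from the edge set `F`. -/
def Reach (G : Multigraph V E) (F : Set E) : V → V → Prop :=
  Relation.ReflTransGen (G.AdjOn F)

/-- `(S, F)` is a (sub)tree of `G`: `S` is nonempty, every edge of `F` has
both endpoints in `S`, the subgraph `(S, F)` is connected, and
`|F| + 1 = |S|` (for a connected subgraph this says exactly that it is
acyclic, i.e. a tree). -/
def IsTree (G : Multigraph V E) (S : Set V) (F : Set E) : Prop :=
  S.Nonempty ∧ (∀ e ∈ F, ∀ v, v ∈ G.inc e → v ∈ S) ∧
    (∀ a ∈ S, ∀ b ∈ S, G.Reach F a b) ∧ F.ncard + 1 = S.ncard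

/-- `τ(G)`: the number of spanning trees of `G` (a spanning tree is identified
with its edge set; `τ(G) = 0` when `G` is disconnected). -/
noncomputable def tau (G : Multigraph V E) : ℕ :=
  {F : Set E | G.IsTree Set.univ F}.ncard

/-- The induced subgraph `G[S]` is connected. -/
def ConnectedOn (G : Multigraph V E) (S : Set V) : Prop :=
  S.Nonempty ∧ ∀ a ∈ S, ∀ b ∈ S, G.Reach {e | ∀ w, w ∈ G.inc e → w ∈ S} a b

/-- `G` is connected. -/
def Connected (G : Multigraph V E) : Prop :=
  G.ConnectedOn Set.univ

/-- `NST_u(G)`: the set of non-spanning subtrees of `G` containing `u`,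
each subtree given as a pair (vertex set, edge set). -/
def NST (G : Multigraph V E) (u : V) : Set (Set V × Set E) :=
  {p | G.IsTree p.1 p.2 ∧ u ∈ p.1 ∧ p.1 ≠ Set.univ}

/-- The functional graph on vertices induced by a choice `f` of one edge at every vertex
other than `r`: `v` steps to the other endpoint of `f v`. -/
def Step (G : Multigraph V E) (r : V) (f : ({r}ᶜ : Set V) → E) (v w : V) : Prop :=
  ∃ h : v ∈ ({r}ᶜ : Set V), G.inc (f ⟨v, h⟩) = s(v, w)

/-- The vertices from which `r` is reached by iterating `Step`. -/
def basin (G : Multigraph V E) (r : V) (f : ({r}ᶜ : Set V) → E) : Set V :=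
  {v | Relation.ReflTransGen (G.Step r f) v r}

/-- The edges chosen by `f` at the vertices of its basin. -/
def basinEdges (G : Multigraph V E) (r : V) (f : ({r}ᶜ : Set V) → E) : Set E :=
  f '' {v | (v : V) ∈ G.basin r f}

theorem root_mem_basin (G : Multigraph V E) (r : V) (f : ({r}ᶜ : Set V) → E) :
    r ∈ G.basin r f :=
  Relation.ReflTransGen.refl

theorem Step.eq {G : Multigraph V E} {r : V} {f : ({r}ᶜ : Set V) → E} {v w w' : V}
    (h : G.Step r f v w) (h' : G.Step r f v w') : w = w' := by
  obtain ⟨_, h⟩ := h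
  obtain ⟨_, h'⟩ := h'
  exact Sym2.congr_right.mp (h.symm.trans h')

theorem Step.mem_basin {G : Multigraph V E} {r : V} {f : ({r}ᶜ : Set V) → E} {v w : V}
    (h : G.Step r f v w) (hw : w ∈ G.basin r f) : v ∈ G.basin r f :=
  Relation.ReflTransGen.head h hw

theorem Step.mem_basin_right {G : Multigraph V E} {r : V} {f : ({r}ᶜ : Set V) → E} {v w : V}
    (h : G.Step r f v w) (hv : v ∈ G.basin r f) : w ∈ G.basin r f := by
  rcases Relation.ReflTransGen.cases_head hv with rfl | ⟨u, hu, hur⟩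
  · exact absurd rfl h.1
  · rwa [h.eq hu]

/-- No vertex of the basin lies on a cycle of length two. -/
theorem Step.not_step_of_mem_basin {G : Multigraph V E} {r : V} {f : ({r}ᶜ : Set V) → E}
    {v w : V} (h : G.Step r f v w) (hv : v ∈ G.basin r f) : ¬ G.Step r f w v := by
  intro h'
  have key : ∀ x, x ∈ G.basin r f → x ≠ v ∧ x ≠ w := by
    intro x hx
    induction hx using Relation.ReflTransGen.head_induction_on with
    | refl => exact ⟨fun e => h.1 e.symm, fun e => h'.1 e.symm⟩
    | head hxy _ ih =>
      refine ⟨?_, ?_⟩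
      · rintro rfl
        exact ih.2 (hxy.eq h)
      · rintro rfl
        exact ih.1 (hxy.eq h')
  exact (key v hv).1 rfl

theorem exists_step {G : Multigraph V E} {r : V} {f : ({r}ᶜ : Set V) → E}
    {v : ({r}ᶜ : Set V)} (hf : (v : V) ∈ G.inc (f v)) : ∃ w, G.Step r f v w := by
  obtain ⟨w, hw⟩ := hf
  exact ⟨w, v.2, hw⟩

theorem injOn_basin {G : Multigraph V E} {r : V} {f : ({r}ᶜ : Set V) → E}
    (hf : ∀ v : ({r}ᶜ : Set V), (v : V) ∈ G.inc (f v)) :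
    Set.InjOn f {v | (v : V) ∈ G.basin r f} := by
  intro v hv w hw hvw
  by_contra hne
  have hne' : (v : V) ≠ w := fun h => hne (Subtype.ext h)
  have h : G.inc (f v) = s((v : V), (w : V)) :=
    (Sym2.mem_and_mem_iff hne').mp ⟨hf v, hvw ▸ hf w⟩
  have h' : G.inc (f w) = s((w : V), (v : V)) := by rw [← hvw, h, Sym2.eq_swap]
  exact Step.not_step_of_mem_basin (G := G) (f := f) ⟨v.2, h⟩ hv ⟨w.2, h'⟩

theorem AdjOn.symm {G : Multigraph V E} {F : Set E} {a b : V} (h : G.AdjOn F a b) :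
    G.AdjOn F b a := by
  obtain ⟨e, he, h⟩ := h
  exact ⟨e, he, h.trans Sym2.eq_swap⟩

theorem Reach.symm {G : Multigraph V E} {F : Set E} {a b : V} (h : G.Reach F a b) :
    G.Reach F b a :=
  have : Std.Symm (G.AdjOn F) := ⟨fun _ _ => AdjOn.symm⟩
  Relation.ReflTransGen.stdSymm.symm _ _ h

theorem ncard_subtype_compl_singleton [Finite V] {r : V} {S : Set V} (hr : r ∈ S) :
    {v : ({r}ᶜ : Set V) | (v : V) ∈ S}.ncard + 1 = S.ncard := by
  have h : ((↑) : ({r}ᶜ : Set V) → V) '' {v | (v : V) ∈ S} = S \ {r} := by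
    ext v
    simp [and_comm]
  rw [← Set.ncard_image_of_injective _ Subtype.val_injective, h,
    Set.ncard_sdiff_singleton_add_one hr]

theorem isTree_basin [Finite V] {G : Multigraph V E} {r : V} {f : ({r}ᶜ : Set V) → E}
    (hf : ∀ v : ({r}ᶜ : Set V), (v : V) ∈ G.inc (f v)) :
    G.IsTree (G.basin r f) (G.basinEdges r f) := by
  refine ⟨⟨r, G.root_mem_basin r f⟩, ?_, ?_, ?_⟩
  · rintro _ ⟨v, hv, rfl⟩ x hx
    obtain ⟨w, hw⟩ := exists_step (hf v)
    obtain ⟨h, hi⟩ := id hw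
    rw [hi, Sym2.mem_iff] at hx
    rcases hx with rfl | rfl
    · exact hv
    · exact hw.mem_basin_right hv
  · have key : ∀ x ∈ G.basin r f, G.Reach (G.basinEdges r f) x r := by
      intro x hx
      induction hx using Relation.ReflTransGen.head_induction_on with
      | refl => exact Relation.ReflTransGen.refl
      | @head x y hxy hy ih =>
        have hx : x ∈ G.basin r f := hxy.mem_basin hy
        obtain ⟨h, hi⟩ := hxy
        exact Relation.ReflTransGen.head ⟨_, ⟨⟨x, h⟩, hx, rfl⟩, hi⟩ ih
    exact fun a ha b hb => (key a ha).trans (key b hb).symm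
  · rw [basinEdges, Set.InjOn.ncard_image (injOn_basin hf),
      ncard_subtype_compl_singleton (G.root_mem_basin r f)]

/-- Distances to `r`: a function decreasing along some incident edge at every vertex. -/
theorem exists_rank (G : Multigraph V E) (F : Set E) (r : V) :
    ∃ d : V → ℕ, ∀ v, G.Reach F r v → v ≠ r → ∃ w, G.AdjOn F v w ∧ d w < d v := by
  let R : ℕ → V → Prop := fun k =>
    Nat.rec (fun v => v = r) (fun _ P v => ∃ w, P w ∧ G.AdjOn F v w) k
  have hR : ∀ v, G.Reach F r v → ∃ k, R k v := by
    intro v hv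
    induction hv with
    | refl => exact ⟨0, rfl⟩
    | tail _ hbc ih =>
      obtain ⟨k, hk⟩ := ih
      exact ⟨k + 1, _, hk, hbc.symm⟩
  refine ⟨fun v => sInf {k | R k v}, fun v hv hne => ?_⟩
  have hmem : R (sInf {k | R k v}) v := Nat.sInf_mem (hR v hv)
  rcases hk : sInf {k | R k v} with _ | k
  · rw [hk] at hmem
    exact absurd hmem hne
  · rw [hk] at hmem
    obtain ⟨w, hw, hvw⟩ := hmem
    refine ⟨w, hvw, ?_⟩
    dsimp only
    rw [hk]
    exact Nat.lt_succ_of_le (Nat.sInf_le hw)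

/-- Every tree containing `r` can be oriented towards `r`. -/
theorem IsTree.exists_orientation [Finite V] [Finite E] {G : Multigraph V E} {r : V}
    {S : Set V} {F : Set E} (hT : G.IsTree S F) (hr : r ∈ S)
    (hE : Nonempty (({r}ᶜ : Set V) → E)) :
    ∃ g : ({r}ᶜ : Set V) → E, (∀ v : ({r}ᶜ : Set V), (v : V) ∈ S → (v : V) ∈ G.inc (g v)) ∧
      S ⊆ G.basin r g ∧ Set.InjOn g {v | (v : V) ∈ S} ∧ g '' {v | (v : V) ∈ S} = F := by
  obtain ⟨_, hinc, hreach, hcard⟩ := hT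
  obtain ⟨g₀⟩ := hE
  obtain ⟨d, hd⟩ := G.exists_rank F r
  have hg : ∀ v : ({r}ᶜ : Set V), ∃ e, (v : V) ∈ S →
      ∃ w, e ∈ F ∧ G.inc e = s((v : V), w) ∧ d w < d v := by
    intro v
    by_cases hv : (v : V) ∈ S
    · obtain ⟨w, ⟨e, he, hi⟩, hlt⟩ := hd v (hreach r hr v hv) v.2
      exact ⟨e, fun _ => ⟨w, he, hi, hlt⟩⟩
    · exact ⟨g₀ v, fun h => absurd h hv⟩
  choose g hg using hg
  have hinj : Set.InjOn g {v | (v : V) ∈ S} := by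
    intro v hv w hw hvw
    by_contra hne
    have hne' : (v : V) ≠ w := fun h => hne (Subtype.ext h)
    obtain ⟨v', _, hvi, hv'⟩ := hg v hv
    obtain ⟨w', _, hwi, hw'⟩ := hg w hw
    have h1 : (w : V) ∈ G.inc (g v) := by rw [hvw, hwi]; exact Sym2.mem_mk_left _ _
    have h2 : (v : V) ∈ G.inc (g w) := by rw [← hvw, hvi]; exact Sym2.mem_mk_left _ _
    rw [hvi, Sym2.mem_iff] at h1
    rw [hwi, Sym2.mem_iff] at h2
    have e1 : (w : V) = v' := h1.resolve_left (Ne.symm hne')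
    have e2 : (v : V) = w' := h2.resolve_left hne'
    rw [← e1] at hv'
    rw [← e2] at hw'
    exact lt_asymm hv' hw'
  refine ⟨g, ?_, ?_, hinj, ?_⟩
  · intro v hv
    obtain ⟨w, _, hi, _⟩ := hg v hv
    rw [hi]
    exact Sym2.mem_mk_left _ _
  · intro v hv
    induction hk : d v using Nat.strong_induction_on generalizing v with
    | _ k ih =>
      by_cases hvr : v = r
      · rw [hvr]
        exact G.root_mem_basin r g
      · obtain ⟨w, he, hi, hlt⟩ := hg ⟨v, hvr⟩ hv
        have hw : w ∈ S := hinc _ he w (by rw [hi]; exact Sym2.mem_mk_right _ _)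
        exact Step.mem_basin ⟨hvr, hi⟩ (ih (d w) (hk ▸ hlt) hw rfl)
  · refine Set.eq_of_subset_of_ncard_le ?_ ?_ (Set.toFinite F)
    · rintro _ ⟨v, hv, rfl⟩
      obtain ⟨_, he, _⟩ := hg v hv
      exact he
    · rw [Set.InjOn.ncard_image hinj]
      have := ncard_subtype_compl_singleton hr
      omega

/-- The choices whose basin is a given tree are those extending its orientation towards `r`
by edges avoiding the tree. -/
theorem basin_eq_iff {G : Multigraph V E} {r : V} {S : Set V} {F : Set E} (hr : r ∈ S)
    {g : ({r}ᶜ : Set V) → E} (hgi : ∀ v : ({r}ᶜ : Set V), (v : V) ∈ S → (v : V) ∈ G.inc (g v))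
    (hgS : S ⊆ G.basin r g) (hgF : g '' {v | (v : V) ∈ S} = F)
    (hF : ∀ e ∈ F, ∀ v, v ∈ G.inc e → v ∈ S) (f : ({r}ᶜ : Set V) → E) :
    ((∀ v : ({r}ᶜ : Set V), (v : V) ∈ G.inc (f v)) ∧ (G.basin r f, G.basinEdges r f) = (S, F)) ↔
      ∀ v : ({r}ᶜ : Set V), ((v : V) ∈ S → f v = g v) ∧
        ((v : V) ∉ S → (v : V) ∈ G.inc (f v) ∧ ∀ w, w ∈ G.inc (f v) → w ∉ S) := by
  constructor
  · rintro ⟨hf, hp⟩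
    obtain ⟨hS, hE⟩ := Prod.mk.inj hp
    have key : ∀ x, x ∈ G.basin r f → ∀ h : x ∈ ({r}ᶜ : Set V), f ⟨x, h⟩ = g ⟨x, h⟩ := by
      intro x hx
      induction hx using Relation.ReflTransGen.head_induction_on with
      | refl => exact fun h => absurd rfl h
      | @head x y hxy hy ih =>
        intro h
        have hx : x ∈ G.basin r f := hxy.mem_basin hy
        obtain ⟨_, hi⟩ := id hxy
        have hmem : f ⟨x, h⟩ ∈ g '' {v | (v : V) ∈ S} := by
          rw [hgF, ← hE]
          exact ⟨_, hx, rfl⟩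
        obtain ⟨u, hu, hgu⟩ := hmem
        have hu' := hgi u hu
        rw [hgu, hi, Sym2.mem_iff] at hu'
        rcases hu' with hux | huy
        · rw [← hgu]
          congr 1
          exact Subtype.ext hux
        · have hyr : y ∈ ({r}ᶜ : Set V) := huy ▸ u.2
          have hfy : f ⟨y, hyr⟩ = f ⟨x, h⟩ := by
            rw [ih hyr, ← hgu]
            congr 1
            exact Subtype.ext huy.symm
          have hyx := injOn_basin hf (x₁ := ⟨y, hyr⟩) hy hx hfy
          refine absurd ?_ (G.loopless (f ⟨x, h⟩))
          rw [hi, Sym2.mk_isDiag_iff]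
          exact (Subtype.ext_iff.mp hyx).symm
    intro v
    refine ⟨fun hv => key v (hS ▸ hv) v.2, fun hv => ⟨hf v, fun w hw hwS => ?_⟩⟩
    obtain ⟨x, hx⟩ := exists_step (hf v)
    obtain ⟨_, hi⟩ := id hx
    rw [hi, Sym2.mem_iff] at hw
    rcases hw with rfl | rfl
    · exact hv hwS
    · exact hv (hS ▸ hx.mem_basin (hS ▸ hwS))
  · intro h
    have hf : ∀ v : ({r}ᶜ : Set V), (v : V) ∈ G.inc (f v) := by
      intro v
      by_cases hv : (v : V) ∈ S
      · rw [(h v).1 hv]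
        exact hgi v hv
      · exact ((h v).2 hv).1
    have hS : G.basin r f = S := by
      apply Set.Subset.antisymm
      · intro x hx
        induction hx using Relation.ReflTransGen.head_induction_on with
        | refl => exact hr
        | @head x y hxy _ ih =>
          by_contra hx
          obtain ⟨hxr, hi⟩ := hxy
          exact ((h ⟨x, hxr⟩).2 hx).2 y (by rw [hi]; exact Sym2.mem_mk_right _ _) ih
      · intro x hxS
        have hx := hgS hxS
        revert hxS
        induction hx using Relation.ReflTransGen.head_induction_on with
        | refl => exact fun _ => G.root_mem_basin r f
        | @head x y hxy _ ih =>
          intro hxS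
          obtain ⟨hxr, hi⟩ := hxy
          have hy : y ∈ S := hF (g ⟨x, hxr⟩) (hgF ▸ ⟨_, hxS, rfl⟩) y
            (by rw [hi]; exact Sym2.mem_mk_right _ _)
          refine Step.mem_basin ⟨hxr, ?_⟩ (ih hy)
          rw [(h ⟨x, hxr⟩).1 hxS, hi]
    refine ⟨hf, Prod.ext hS ?_⟩
    change G.basinEdges r f = F
    rw [basinEdges, hS, ← hgF]
    exact Set.image_congr fun v hv => (h v).1 hv

open scoped Classical in
/-- The choices with a given tree as basin contribute the weight of the tree times the degree
product of the complement. -/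
theorem IsTree.sum_basin_fiber {R : Type*} [CommSemiring R] [Fintype V] [Fintype E]
    {G : Multigraph V E} {r : V} {S : Set V} {F : Set E} (hT : G.IsTree S F) (hr : r ∈ S)
    (hE : Nonempty (({r}ᶜ : Set V) → E)) (y : E → R) :
    ∑ f : ({r}ᶜ : Set V) → E with
        (∀ v : ({r}ᶜ : Set V), (v : V) ∈ G.inc (f v)) ∧ (G.basin r f, G.basinEdges r f) = (S, F),
      ∏ v, y (f v) =
    (∏ᶠ e ∈ F, y e) *
      ∏ᶠ v ∈ Sᶜ, ∑ᶠ e ∈ {e : E | v ∈ G.inc e ∧ ∀ w, w ∈ G.inc e → w ∉ S}, y e := by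
  obtain ⟨g, hgi, hgS, hinj, hgF⟩ := hT.exists_orientation hr hE
  set A : V → Set E := fun v => {e : E | v ∈ G.inc e ∧ ∀ w, w ∈ G.inc e → w ∉ S}
  let t : ({r}ᶜ : Set V) → Finset E := fun v =>
    if (v : V) ∈ S then {g v} else (A v).toFinset
  have hfilter : (Finset.univ.filter fun f : ({r}ᶜ : Set V) → E =>
      (∀ v : ({r}ᶜ : Set V), (v : V) ∈ G.inc (f v)) ∧ (G.basin r f, G.basinEdges r f) = (S, F)) =
      Fintype.piFinset t := by
    ext f
    rw [Finset.mem_filter, Fintype.mem_piFinset, basin_eq_iff hr hgi hgS hgF hT.2.1 f]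
    simp only [Finset.mem_univ, true_and]
    refine forall_congr' fun v => ?_
    by_cases hv : (v : V) ∈ S <;> simp [t, hv, A]
  rw [hfilter, ← Finset.prod_univ_sum]
  have hsplit : ∀ v : ({r}ᶜ : Set V), ∑ e ∈ t v, y e =
      (if (v : V) ∈ S then y (g v) else 1) *
        (if (v : V) ∈ S then 1 else ∑ᶠ e ∈ A v, y e) := by
    intro v
    by_cases hv : (v : V) ∈ S
    · simp [t, hv]
    · simp only [t, hv, if_false, one_mul]
      rw [finsum_mem_eq_toFinset_sum]
  rw [Finset.prod_congr rfl fun v _ => hsplit v, Finset.prod_mul_distrib]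
  congr 1
  · rw [← hgF, finprod_mem_image hinj, finprod_mem_def, finprod_eq_prod_of_fintype]
    refine Finset.prod_congr rfl fun v _ => ?_
    simp [Set.mulIndicator_apply]
  · rw [← finprod_eq_prod_of_fintype, finprod_set_coe_eq_finprod_mem (s := ({r}ᶜ : Set V))
      (f := fun v => if v ∈ S then 1 else ∑ᶠ e ∈ A v, y e), finprod_mem_def, finprod_mem_def]
    refine finprod_congr fun v => ?_
    by_cases hv : v ∈ S
    · simp [Set.mulIndicator_apply, hv]
    · have : v ≠ r := fun h => hv (h ▸ hr)
      simp [A, hv, this]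

theorem Connected.nonempty_choice {G : Multigraph V E} (hG : G.Connected) (r : V) :
    Nonempty (({r}ᶜ : Set V) → E) := by
  have h : ∀ v : ({r}ᶜ : Set V), ∃ _ : E, True := by
    intro v
    rcases Relation.ReflTransGen.cases_head (hG.2 v trivial r trivial) with h | ⟨_, ⟨e, _⟩, _⟩
    · exact absurd h v.2
    · exact ⟨e, trivial⟩
  choose f _ using h
  exact ⟨f⟩

/-- The degree product away from `r` as a sum over all trees containing `r`. -/
theorem finprod_deg_eq_finsum_isTree {R : Type*} [CommSemiring R] [Fintype V] [Fintype E]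
    {G : Multigraph V E} (hG : G.Connected) (r : V) (y : E → R) :
    ∏ᶠ v ∈ ({r}ᶜ : Set V), ∑ᶠ e ∈ {e : E | v ∈ G.inc e}, y e =
      ∑ᶠ p ∈ {p : Set V × Set E | G.IsTree p.1 p.2 ∧ r ∈ p.1},
        (∏ᶠ e ∈ p.2, y e) *
          ∏ᶠ v ∈ p.1ᶜ, ∑ᶠ e ∈ {e : E | v ∈ G.inc e ∧ ∀ w, w ∈ G.inc e → w ∉ p.1}, y e := by
  classical
  have hE := hG.nonempty_choice r
  rw [← finprod_set_coe_eq_finprod_mem (s := ({r}ᶜ : Set V))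
    (f := fun v => ∑ᶠ e ∈ {e : E | v ∈ G.inc e}, y e), finprod_eq_prod_of_fintype]
  simp_rw [finsum_mem_eq_toFinset_sum]
  rw [Finset.prod_univ_sum,
    ← Finset.sum_fiberwise_of_maps_to (s := Fintype.piFinset _)
      (t := {p : Set V × Set E | G.IsTree p.1 p.2 ∧ r ∈ p.1}.toFinset)
      (g := fun f => (G.basin r f, G.basinEdges r f))]
  · refine Finset.sum_congr rfl fun p hp => ?_
    rw [Set.mem_toFinset] at hp
    have h := hp.1.sum_basin_fiber hp.2 hE y
    simp_rw [finsum_mem_eq_toFinset_sum] at h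
    rw [← h]
    refine Finset.sum_congr ?_ fun _ _ => rfl
    ext f
    simp [Fintype.mem_piFinset]
  · intro f hf
    rw [Set.mem_toFinset]
    exact ⟨isTree_basin fun v => by simpa using Fintype.mem_piFinset.mp hf v,
      G.root_mem_basin r f⟩

open MvPolynomial in
/-- For a loopless connected multigraph `G` with vertices `v_1, …, v_{n+1}`
(modelled as `Fin (n+1)`, the last vertex playing the role of `v_n` of the
paper) and edge weights `ω(e) = y_e` (the indeterminate `X e`), one has
`∏_{i≤n} (∑_{e ∈ E(v_i)} y_e) = τ(G,ω) + ∑_{T₀ ∈ NST_{v_{n+1}}(G)} τ(T₀,ω)·F(G−V(T₀),ω)`,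
where `τ(G,ω) = ∑_{T spanning tree} ∏_{e ∈ E(T)} y_e`,
`τ(T₀,ω) = ∏_{e ∈ E(T₀)} y_e`, and
`F(H,ω) = ∏_{v ∈ V(H)} ∑_{e ∈ E_H(v)} y_e` (with `F = 1` for the empty graph). -/
theorem prod_deg_weight_identity {E : Type} [Fintype E] (n : ℕ)
    (G : Multigraph (Fin (n + 1)) E) (hG : G.Connected) :
    (∏ᶠ v ∈ ({Fin.last n}ᶜ : Set (Fin (n + 1))),
        ∑ᶠ e ∈ {e : E | v ∈ G.inc e}, (X e : MvPolynomial E ℤ)) =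
      (∑ᶠ F ∈ {F : Set E | G.IsTree Set.univ F},
          ∏ᶠ e ∈ F, (X e : MvPolynomial E ℤ)) +
        ∑ᶠ p ∈ G.NST (Fin.last n),
          (∏ᶠ e ∈ p.2, (X e : MvPolynomial E ℤ)) *
            ∏ᶠ v ∈ p.1ᶜ,
              ∑ᶠ e ∈ {e : E | v ∈ G.inc e ∧ ∀ w, w ∈ G.inc e → w ∉ p.1},
                (X e : MvPolynomial E ℤ) := by
  rw [finprod_deg_eq_finsum_isTree hG (Fin.last n) (X : E → MvPolynomial E ℤ)]
  have hsplit : {p : Set (Fin (n + 1)) × Set E | G.IsTree p.1 p.2 ∧ Fin.last n ∈ p.1} =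
      Prod.mk Set.univ '' {F : Set E | G.IsTree Set.univ F} ∪ G.NST (Fin.last n) := by
    ext ⟨S, F⟩
    simp only [NST, Set.mem_ofPred_eq, Set.mem_union, Set.mem_image, Prod.mk.injEq]
    constructor
    · rintro ⟨hT, hr⟩
      by_cases hS : S = Set.univ
      · subst hS
        exact Or.inl ⟨F, hT, rfl, rfl⟩
      · exact Or.inr ⟨hT, hr, hS⟩
    · rintro (⟨F, hT, rfl, rfl⟩ | ⟨hT, hr, _⟩)
      · exact ⟨hT, Set.mem_univ _⟩
      · exact ⟨hT, hr⟩
  have hdisj : Disjoint (Prod.mk Set.univ '' {F : Set E | G.IsTree Set.univ F})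
      (G.NST (Fin.last n)) := by
    rw [Set.disjoint_left]
    rintro _ ⟨F, _, rfl⟩ h
    exact h.2.2 rfl
  rw [hsplit, finsum_mem_union hdisj (Set.toFinite _) (Set.toFinite _),
    finsum_mem_image fun _ _ _ _ h => (Prod.mk.inj h).2]
  simp

end Multigraph
end

section
/- Let G = (V, E) be a loopless connected multigraph with V = {v_1, …, v_n} and let 𝕊 be the family of all subsets S of {(e_j, v_i) : i ∈ [n−1], e_j ∈ E_G(v_i)} such that S contains exactly one pair (e_j, v_i) for each i ∈ [n−1]. For S ∈ 𝕊, let ⟨G⟩_S be the spanning subgraph of G with edge set E(S) = {e_j : (e_j, v_i) ∈ S for some i}. Then for every S ∈ 𝕊, the connected component of ⟨G⟩_S containing v_n is a tree. -/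
namespace Multigraph

variable {V E : Type}

/-- The family `𝕊` of all sets `S` of pairs `(e, v)` with `v ≠ v_{n+1}`
(the last vertex) and `e` incident with `v`, containing exactly one pair
`(e, v)` for every vertex `v ≠ v_{n+1}`. -/
def Sys {E : Type} {n : ℕ} (G : Multigraph (Fin (n + 1)) E) :
    Set (Set (E × Fin (n + 1))) :=
  {S | (∀ p ∈ S, p.2 ≠ Fin.last n ∧ p.2 ∈ G.inc p.1) ∧
    ∀ v : Fin (n + 1), v ≠ Fin.last n → ∃! e : E, (e, v) ∈ S}

/-- `E(S)`: the edge set of the spanning subgraph `⟨G⟩_S` determined by a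
set `S` of (edge, vertex) pairs. -/
def sysEdges {E : Type} {n : ℕ} (S : Set (E × Fin (n + 1))) : Set E :=
  {e | ∃ v, (e, v) ∈ S}

/-- The vertex set of the connected component `⟨G_{v_{n+1}}⟩_S` of the
spanning subgraph `⟨G⟩_S` containing the last vertex. -/
def compVerts {E : Type} {n : ℕ} (G : Multigraph (Fin (n + 1)) E)
    (S : Set (E × Fin (n + 1))) : Set (Fin (n + 1)) :=
  {v | G.Reach (sysEdges S) (Fin.last n) v}

/-- The edge set of the connected component `⟨G_{v_{n+1}}⟩_S` of the
spanning subgraph `⟨G⟩_S` containing the last vertex. -/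
def compEdges {E : Type} {n : ℕ} (G : Multigraph (Fin (n + 1)) E)
    (S : Set (E × Fin (n + 1))) : Set E :=
  {e ∈ sysEdges S | ∃ w, w ∈ G.inc e ∧ w ∈ G.compVerts S}

/-- The simple graph on `S` joining two vertices whenever some edge of `F` does. -/
def toSimpleGraph (G : Multigraph V E) (S : Set V) (F : Set E) : SimpleGraph S where
  Adj a b := G.AdjOn F a b
  symm := ⟨fun _ _ h => h.symm⟩
  loopless := ⟨fun a ⟨e, _, he⟩ => G.loopless e (by simp [he])⟩

theorem Reach.reachable_toSimpleGraph {G : Multigraph V E} {S : Set V} {F : Set E}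
    (hF : ∀ e ∈ F, ∀ v, v ∈ G.inc e → v ∈ S) {a b : V} (h : G.Reach F a b)
    (ha : a ∈ S) (hb : b ∈ S) : (G.toSimpleGraph S F).Reachable ⟨a, ha⟩ ⟨b, hb⟩ := by
  induction h with
  | refl => exact SimpleGraph.Reachable.refl _
  | @tail b c _ hbc ih =>
    obtain ⟨e, he, hinc⟩ := id hbc
    have hbS : b ∈ S := hF e he b (by simp [hinc])
    exact (ih hbS).trans
      (SimpleGraph.Adj.reachable (G := G.toSimpleGraph S F) (u := ⟨b, hbS⟩) (v := ⟨c, hb⟩) hbc)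

/-- A connected subgraph has at most one more vertex than it has edges. -/
theorem ncard_le_ncard_add_one_of_reach {G : Multigraph V E} {S : Set V} {F : Set E}
    (hfin : F.Finite) (hS : S.Nonempty) (hF : ∀ e ∈ F, ∀ v, v ∈ G.inc e → v ∈ S)
    (hconn : ∀ a ∈ S, ∀ b ∈ S, G.Reach F a b) : S.ncard ≤ F.ncard + 1 := by
  have : Nonempty S := hS.to_subtype
  have : Finite F := hfin
  have hH : (G.toSimpleGraph S F).Connected :=
    ⟨fun a b => (hconn a a.2 b b.2).reachable_toSimpleGraph hF a.2 b.2⟩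
  have hex : ∀ x : (G.toSimpleGraph S F).edgeSet,
      ∃ e : F, G.inc e = Sym2.map Subtype.val x.1 := by
    rintro ⟨x, hx⟩
    induction x using Sym2.ind with
    | _ a b =>
      obtain ⟨e, he, hab⟩ := hx
      exact ⟨⟨e, he⟩, hab⟩
  choose f hf using hex
  have hinj : Function.Injective f := fun x y hxy =>
    Subtype.ext (Sym2.map.injective Subtype.val_injective (by rw [← hf, ← hf, hxy]))
  rw [← Nat.card_coe_set_eq, ← Nat.card_coe_set_eq]
  exact hH.card_vert_le_card_edgeSet_add_one.trans
    (Nat.add_le_add_right (Nat.card_le_card_of_injective f hinj) 1)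

section Component

variable {n : ℕ} {G : Multigraph (Fin (n + 1)) E} {S : Set (E × Fin (n + 1))}

theorem last_mem_compVerts : Fin.last n ∈ G.compVerts S :=
  Relation.ReflTransGen.refl

theorem mem_compVerts_of_mem_inc {e : E} (he : e ∈ G.compEdges S) {v : Fin (n + 1)}
    (hv : v ∈ G.inc e) : v ∈ G.compVerts S := by
  obtain ⟨heS, w, hw, hwC⟩ := he
  by_cases hwv : w = v
  · exact hwv ▸ hwC
  · exact Relation.ReflTransGen.tail hwC ⟨e, heS, (Sym2.mem_and_mem_iff hwv).1 ⟨hw, hv⟩⟩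

theorem reach_compEdges {v : Fin (n + 1)} (hv : v ∈ G.compVerts S) :
    G.Reach (G.compEdges S) (Fin.last n) v := by
  induction hv with
  | refl => exact Relation.ReflTransGen.refl
  | @tail b c hb hbc ih =>
    obtain ⟨e, he, hinc⟩ := hbc
    exact ih.tail ⟨e, ⟨he, b, by simp [hinc], hb⟩, hinc⟩

/-- Distinct edges of the component are chosen by distinct vertices of it, none of them the
last one. -/
theorem ncard_compEdges_lt (hS : S ∈ G.Sys) :
    (G.compEdges S).ncard < (G.compVerts S).ncard := by
  have hex : ∀ e ∈ G.compEdges S, ∃ v, (e, v) ∈ S := fun e he => he.1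
  choose! f hf using hex
  calc (G.compEdges S).ncard
      ≤ (G.compVerts S \ {Fin.last n}).ncard := by
        refine Set.ncard_le_ncard_of_injOn f (fun e he => ?_) (fun e he e' he' hee' => ?_)
          (Set.toFinite _)
        · obtain ⟨hlast, hinc⟩ := hS.1 _ (hf e he)
          exact ⟨mem_compVerts_of_mem_inc he hinc, hlast⟩
        · exact (hS.2 (f e) (hS.1 _ (hf e he)).1).unique (hf e he) (hee' ▸ hf e' he')
    _ < (G.compVerts S).ncard :=
        Set.ncard_sdiff_singleton_lt_of_mem last_mem_compVerts (Set.toFinite _)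

end Component

/-- For a loopless connected multigraph `G` with vertices `v_1, …, v_{n+1}`
and any `S ∈ 𝕊`, the connected component of the spanning subgraph `⟨G⟩_S`
containing the last vertex `v_{n+1}` is a tree. -/
theorem comp_isTree {E : Type} [Fintype E] (n : ℕ)
    (G : Multigraph (Fin (n + 1)) E) (hG : G.Connected) :
    ∀ S ∈ G.Sys, G.IsTree (G.compVerts S) (G.compEdges S) := by
  intro S hS
  have hne : (G.compVerts S).Nonempty := ⟨_, last_mem_compVerts⟩
  have hinc : ∀ e ∈ G.compEdges S, ∀ v, v ∈ G.inc e → v ∈ G.compVerts S :=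
    fun _ he _ hv => mem_compVerts_of_mem_inc he hv
  have hconn : ∀ a ∈ G.compVerts S, ∀ b ∈ G.compVerts S, G.Reach (G.compEdges S) a b :=
    fun _ ha _ hb => (reach_compEdges ha).symm.trans (reach_compEdges hb)
  exact ⟨hne, hinc, hconn, le_antisymm (ncard_compEdges_lt hS)
    (ncard_le_ncard_add_one_of_reach (Set.toFinite _) hne hinc hconn)⟩

end Multigraph
end

section
/- Let G = (V, E) be a loopless connected multigraph with V = {v_1, …, v_n} and let 𝕊 be the family of all subsets S of {(e_j, v_i) : i ∈ [n−1], e_j ∈ E_G(v_i)} containing exactly one pair (e_j, v_i) for each i ∈ [n−1]. For S ∈ 𝕊, let ⟨G_{v_n}⟩_S denote the connected component containing v_n of the spanning subgraph of G with edge set {e_j : (e_j, v_i) ∈ S}. Then for every S ∈ 𝕊, if v_i ∈ V(⟨G_{v_n}⟩_S) \ {v_n} and (e_j, v_i) ∈ S, then e_j is the unique edge of E_G(v_i) lying on the unique path in the tree ⟨G_{v_n}⟩_S connecting v_n and v_i. -/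
namespace Multigraph

variable {V E : Type}

/-- The edge `e` lies on the unique path of the tree `⟨G_{v_{n+1}}⟩_S`
connecting the last vertex `v_{n+1}` and `v`: since the component is a
tree, an edge `e` of it lies on that path if and only if deleting `e`
separates `v_{n+1}` from `v`. -/
def OnCompPath {E : Type} {n : ℕ} (G : Multigraph (Fin (n + 1)) E)
    (S : Set (E × Fin (n + 1))) (e : E) (v : Fin (n + 1)) : Prop :=
  e ∈ G.compEdges S ∧ ¬ G.Reach (G.compEdges S \ {e}) (Fin.last n) v

/-- The vertices reachable from `r` along `F` outnumber the edges of `F` between them by at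
most one. -/
theorem ncard_reach_le [Finite V] [Finite E] (G : Multigraph V E) (F : Set E) (r : V) :
    {x | G.Reach F r x}.ncard ≤ {g ∈ F | ∀ x ∈ G.inc g, G.Reach F r x}.ncard + 1 := by
  let P : Set V → Prop := fun T => r ∈ T ∧ (∀ x ∈ T, G.Reach F r x) ∧
    T.ncard ≤ {g ∈ F | ∀ x ∈ G.inc g, x ∈ T}.ncard + 1
  have hP : P {r} := by
    refine ⟨rfl, ?_, by simp⟩
    rintro x rfl
    exact Relation.ReflTransGen.refl
  obtain ⟨T, hT⟩ := (Set.toFinite {T | P T}).exists_maximal ⟨{r}, hP⟩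
  obtain ⟨hr, hreach, hcard⟩ := hT.prop
  have hall : ∀ x, G.Reach F r x → x ∈ T := by
    intro x hx
    induction hx with
    | refl => exact hr
    | @tail a b hab hstep ih =>
      by_contra hb
      obtain ⟨g, hg, hinc⟩ := hstep
      have hins : P (insert b T) := by
        refine ⟨Set.mem_insert_of_mem _ hr, ?_, ?_⟩
        · rintro y (rfl | hy)
          · exact hab.tail ⟨g, hg, hinc⟩
          · exact hreach y hy
        · have hgT : g ∉ {g ∈ F | ∀ x ∈ G.inc g, x ∈ T} := fun h =>
            hb (h.2 b (by simp [hinc]))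
          have hsub : insert g {g ∈ F | ∀ x ∈ G.inc g, x ∈ T} ⊆
              {g ∈ F | ∀ x ∈ G.inc g, x ∈ insert b T} := by
            rintro k (rfl | hk)
            · refine ⟨hg, fun x hx => ?_⟩
              rw [hinc, Sym2.mem_iff] at hx
              rcases hx with rfl | rfl
              · exact Set.mem_insert_of_mem _ ih
              · exact Set.mem_insert _ _
            · exact ⟨hk.1, fun x hx => Set.mem_insert_of_mem _ (hk.2 x hx)⟩
          have hle := Set.ncard_le_ncard hsub (Set.toFinite _)
          rw [Set.ncard_insert_of_notMem hgT (Set.toFinite _)] at hle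
          rw [Set.ncard_insert_of_notMem hb (Set.toFinite _)]
          omega
      exact hb (hT.le_of_ge hins (Set.subset_insert _ _) (Set.mem_insert _ _))
  have hTeq : T = {x | G.Reach F r x} := Set.Subset.antisymm hreach hall
  rw [hTeq] at hcard
  exact hcard

/-- Deleting the edge chosen by `v` separates `v` from the last vertex. -/
theorem not_reach_diff_chosen {E : Type} [Finite E] {n : ℕ} {G : Multigraph (Fin (n + 1)) E}
    {S : Set (E × Fin (n + 1))} (hS : S ∈ G.Sys) {e : E} {v : Fin (n + 1)} (hev : (e, v) ∈ S)
    {F : Set E} (hF : F ⊆ sysEdges S) : ¬ G.Reach (F \ {e}) (Fin.last n) v := by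
  intro hv
  set A := {x | G.Reach (F \ {e}) (Fin.last n) x} with hA
  have hcard : A.ncard ≤ _ := G.ncard_reach_le (F \ {e}) (Fin.last n)
  have hchooser : ∀ g : E, ∃ u, g ∈ sysEdges S → (g, u) ∈ S := fun g => by
    by_cases h : g ∈ sysEdges S
    · exact h.imp fun _ hu _ => hu
    · exact ⟨v, fun h' => absurd h' h⟩
  choose u hu using hchooser
  have hle : {g ∈ F \ {e} | ∀ x ∈ G.inc g, G.Reach (F \ {e}) (Fin.last n) x}.ncard ≤
      ((A \ {Fin.last n}) \ {v}).ncard := by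
    refine Set.ncard_le_ncard_of_injOn u ?_ ?_ (Set.toFinite _)
    · rintro g ⟨⟨hgF, hge⟩, hg⟩
      have hgu := hu g (hF hgF)
      refine ⟨⟨hg _ (hS.1 _ hgu).2, (hS.1 _ hgu).1⟩, fun h => hge ?_⟩
      rw [Set.mem_singleton_iff] at h
      rw [h] at hgu
      exact (hS.2 v (hS.1 _ hev).1).unique hgu hev
    · rintro g ⟨⟨hgF, -⟩, -⟩ k ⟨⟨hkF, -⟩, -⟩ hgk
      have hgu := hu g (hF hgF)
      have hku := hu k (hF hkF)
      rw [hgk] at hgu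
      exact (hS.2 _ (hS.1 _ hku).1).unique hgu hku
  have hvA : v ∈ A \ {Fin.last n} := ⟨hv, (hS.1 _ hev).1⟩
  have hrA : Fin.last n ∈ A := Relation.ReflTransGen.refl
  have h1 := Set.ncard_sdiff_singleton_add_one hvA (Set.toFinite _)
  have h2 := Set.ncard_sdiff_singleton_add_one hrA (Set.toFinite _)
  omega

/-- Deleting an edge with no endpoint reachable afterwards leaves the component unchanged. -/
theorem reach_compEdges_diff {E : Type} {n : ℕ} {G : Multigraph (Fin (n + 1)) E}
    {S : Set (E × Fin (n + 1))} {f : E}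
    (hf : ∀ x ∈ G.inc f, ¬ G.Reach (G.compEdges S \ {f}) (Fin.last n) x)
    {x : Fin (n + 1)} (hx : x ∈ G.compVerts S) :
    G.Reach (G.compEdges S \ {f}) (Fin.last n) x := by
  induction hx with
  | refl => exact Relation.ReflTransGen.refl
  | @tail a b hab hstep ih =>
    obtain ⟨g, hg, hinc⟩ := hstep
    have ha : a ∈ G.inc g := by simp [hinc]
    refine ih.tail ⟨g, ⟨⟨hg, a, ha, hab⟩, ?_⟩, hinc⟩
    rintro rfl
    exact hf a ha ih

/-- For a loopless connected multigraph `G` with vertices `v_1, …, v_{n+1}`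
and any `S ∈ 𝕊`: if `v` is a vertex of the component `⟨G_{v_{n+1}}⟩_S`
other than `v_{n+1}` and `(e, v) ∈ S`, then `e` is the unique edge
incident with `v` lying on the unique path in the tree `⟨G_{v_{n+1}}⟩_S`
connecting `v_{n+1}` and `v`. -/
theorem chosen_edge_on_path {E : Type} [Fintype E] (n : ℕ)
    (G : Multigraph (Fin (n + 1)) E) (hG : G.Connected) :
    ∀ S ∈ G.Sys, ∀ e : E, ∀ v : Fin (n + 1), (e, v) ∈ S →
      v ∈ G.compVerts S →
        G.OnCompPath S e v ∧
          ∀ f : E, v ∈ G.inc f → G.OnCompPath S f v → f = e := by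
  intro S hS e v hev hv
  refine ⟨⟨⟨⟨v, hev⟩, v, (hS.1 _ hev).2, hv⟩, not_reach_diff_chosen hS hev fun _ h => h.1⟩, ?_⟩
  rintro f hvf ⟨⟨⟨w, hfw⟩, -⟩, hsep⟩
  by_cases hwv : w = v
  · subst hwv
    exact (hS.2 w (hS.1 _ hev).1).unique hfw hev
  · have hw := not_reach_diff_chosen hS hfw (F := G.compEdges S) fun _ h => h.1
    refine absurd (reach_compEdges_diff (fun x hx => ?_) hv) hsep
    rw [(Sym2.mem_and_mem_iff hwv).1 ⟨(hS.1 _ hfw).2, hvf⟩, Sym2.mem_iff] at hx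
    rcases hx with rfl | rfl
    · exact hw
    · exact hsep

end Multigraph
end
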